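/- arXiv:1406.3587 — 4 statements merged into one kernel-verified Lean document; each statement's English description precedes it below -/
import Mathlib

section
/- Rotation rule for the GHR derivative: let f : ℍ → ℍ be differentiable at q and let μ, ν ∈ ℍ be nonzero. Then ν * (∂f/∂q^μ(q)) * ν⁻¹ = ∂f^ν/∂q^{νμ}(q) and ν * (∂f/∂q^{μ*}(q)) * ν⁻¹ = ∂f^ν/∂q^{νμ*}(q), where f^ν : ℍ → ℍ is the function p ↦ ν * f(p) * ν⁻¹ and νμ denotes the quaternion product ν * μ. In particular, if f is real-valued (identified with q ↦ ((f q : ℝ) : ℍ)), then ν * (∂f/∂q^μ(q)) * ν⁻¹ = ∂f/∂q^{νμ}(q). -/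
open Quaternion

/-- The quaternion imaginary unit `i`. -/
def qi : ℍ[ℝ] := ⟨0, 1, 0, 0⟩
/-- The quaternion imaginary unit `j`. -/
def qj : ℍ[ℝ] := ⟨0, 0, 1, 0⟩
/-- The quaternion imaginary unit `k`. -/
def qk : ℍ[ℝ] := ⟨0, 0, 0, 1⟩

/-- The left GHR derivative of `f : ℍ → ℍ` at `q` with rotation parameter `μ`:
`∂f/∂q^μ(q) = (1/4)(D_1 f(q) − D_i f(q)·(μiμ⁻¹) − D_j f(q)·(μjμ⁻¹) − D_k f(q)·(μkμ⁻¹))`. -/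
noncomputable def ghrD (f : ℍ[ℝ] → ℍ[ℝ]) (μ q : ℍ[ℝ]) : ℍ[ℝ] :=
  (4 : ℝ)⁻¹ • (fderiv ℝ f q 1 - fderiv ℝ f q qi * (μ * qi * μ⁻¹)
    - fderiv ℝ f q qj * (μ * qj * μ⁻¹) - fderiv ℝ f q qk * (μ * qk * μ⁻¹))

/-- The left GHR derivative of `f : ℍ → ℍ` at `q` with respect to the conjugate rotated
variable `q^{μ*}`:
`∂f/∂q^{μ*}(q) = (1/4)(D_1 f(q) + D_i f(q)·(μiμ⁻¹) + D_j f(q)·(μjμ⁻¹) + D_k f(q)·(μkμ⁻¹))`. -/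
noncomputable def ghrDStar (f : ℍ[ℝ] → ℍ[ℝ]) (μ q : ℍ[ℝ]) : ℍ[ℝ] :=
  (4 : ℝ)⁻¹ • (fderiv ℝ f q 1 + fderiv ℝ f q qi * (μ * qi * μ⁻¹)
    + fderiv ℝ f q qj * (μ * qj * μ⁻¹) + fderiv ℝ f q qk * (μ * qk * μ⁻¹))

theorem fderiv_conj_apply {f : ℍ[ℝ] → ℍ[ℝ]} {q : ℍ[ℝ]} (hf : DifferentiableAt ℝ f q)
    (ν v : ℍ[ℝ]) :
    fderiv ℝ (fun p => ν * f p * ν⁻¹) q v = ν * fderiv ℝ f q v * ν⁻¹ := by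
  rw [((hf.hasFDerivAt.const_mul ν).mul_const' ν⁻¹).fderiv]
  simp

theorem conj_mul_conj {G₀ : Type*} [GroupWithZero G₀] {ν : G₀} (hν : ν ≠ 0) (a b μ : G₀) :
    ν * a * ν⁻¹ * (ν * μ * b * (ν * μ)⁻¹) = ν * (a * (μ * b * μ⁻¹)) * ν⁻¹ := by
  simp only [mul_inv_rev, mul_assoc, inv_mul_cancel_left₀ hν]

theorem conj_ghrD {f : ℍ[ℝ] → ℍ[ℝ]} {q : ℍ[ℝ]} (hf : DifferentiableAt ℝ f q)
    (μ : ℍ[ℝ]) {ν : ℍ[ℝ]} (hν : ν ≠ 0) :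
    ν * ghrD f μ q * ν⁻¹ = ghrD (fun p => ν * f p * ν⁻¹) (ν * μ) q := by
  simp only [ghrD, fderiv_conj_apply hf, conj_mul_conj hν, mul_smul_comm, smul_mul_assoc,
    mul_sub, sub_mul]

theorem conj_ghrDStar {f : ℍ[ℝ] → ℍ[ℝ]} {q : ℍ[ℝ]} (hf : DifferentiableAt ℝ f q)
    (μ : ℍ[ℝ]) {ν : ℍ[ℝ]} (hν : ν ≠ 0) :
    ν * ghrDStar f μ q * ν⁻¹ = ghrDStar (fun p => ν * f p * ν⁻¹) (ν * μ) q := by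
  simp only [ghrDStar, fderiv_conj_apply hf, conj_mul_conj hν, mul_smul_comm, smul_mul_assoc,
    mul_add, add_mul]

/-- Rotation rule for the GHR derivative:
`ν (∂f/∂q^μ(q)) ν⁻¹ = ∂f^ν/∂q^{νμ}(q)` and `ν (∂f/∂q^{μ*}(q)) ν⁻¹ = ∂f^ν/∂q^{νμ*}(q)`,
where `f^ν(p) = ν * f(p) * ν⁻¹`; in particular for real-valued `f`,
`ν (∂f/∂q^μ(q)) ν⁻¹ = ∂f/∂q^{νμ}(q)`. -/
theorem ghr_rotation_rule (f : ℍ[ℝ] → ℍ[ℝ]) (q : ℍ[ℝ]) (hf : DifferentiableAt ℝ f q)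
    (μ ν : ℍ[ℝ]) (hμ : μ ≠ 0) (hν : ν ≠ 0) :
    ν * ghrD f μ q * ν⁻¹ = ghrD (fun p => ν * f p * ν⁻¹) (ν * μ) q ∧
    ν * ghrDStar f μ q * ν⁻¹ = ghrDStar (fun p => ν * f p * ν⁻¹) (ν * μ) q ∧
    ((∀ p, f p = (((f p).re : ℝ) : ℍ[ℝ])) →
      ν * ghrD f μ q * ν⁻¹ = ghrD f (ν * μ) q) := by
  refine ⟨conj_ghrD hf μ hν, conj_ghrDStar hf μ hν, fun hreal => ?_⟩
  have hconj : (fun p => ν * f p * ν⁻¹) = f := by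
    funext p
    rw [hreal p, ← Quaternion.coe_commutes, mul_assoc, mul_inv_cancel₀ hν, mul_one]
  rw [conj_ghrD hf μ hν, hconj]
end

section
/- First-order Taylor term identity: let f : ℍ → ℝ be differentiable at q. Identifying f with the ℍ-valued function q ↦ ((f q : ℝ) : ℍ), for every increment h ∈ ℍ the real Fréchet differential of f satisfies fderiv ℝ f q h = 4 * re((∂f/∂q(q)) * h), where re denotes the real part of a quaternion. -/
open Quaternion

/-- The derivative of a real-valued map regarded as a quaternion-valued map. -/
theorem Quaternion.fderiv_coe_comp {E : Type*} [NormedAddCommGroup E] [NormedSpace ℝ E]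
    {f : E → ℝ} {x : E} (hf : DifferentiableAt ℝ f x) (v : E) :
    fderiv ℝ (fun p => ((f p : ℝ) : ℍ[ℝ])) x v = ((fderiv ℝ f x v : ℝ) : ℍ[ℝ]) := by
  have key := (algebraMapCLM ℝ ℍ[ℝ]).hasFDerivAt.comp x hf.hasFDerivAt
  have heq : (fun p => ((f p : ℝ) : ℍ[ℝ])) = algebraMapCLM ℝ ℍ[ℝ] ∘ f := rfl
  rw [heq, key.fderiv]
  rfl

theorem qi_components : qi.re = 0 ∧ qi.imI = 1 ∧ qi.imJ = 0 ∧ qi.imK = 0 :=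
  ⟨rfl, rfl, rfl, rfl⟩

theorem qj_components : qj.re = 0 ∧ qj.imI = 0 ∧ qj.imJ = 1 ∧ qj.imK = 0 :=
  ⟨rfl, rfl, rfl, rfl⟩

theorem qk_components : qk.re = 0 ∧ qk.imI = 0 ∧ qk.imJ = 0 ∧ qk.imK = 1 :=
  ⟨rfl, rfl, rfl, rfl⟩

theorem Quaternion.eq_smul_one_add_smul_units (h : ℍ[ℝ]) :
    h = h.re • (1 : ℍ[ℝ]) + h.imI • qi + h.imJ • qj + h.imK • qk := by
  ext <;> simp [qi_components, qj_components, qk_components]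

/-- First-order Taylor term identity: for real-valued `f` differentiable at `q`,
`fderiv ℝ f q h = 4 re((∂f/∂q(q)) h)` for every increment `h`. -/
theorem ghr_first_order_term (f : ℍ[ℝ] → ℝ) (q : ℍ[ℝ]) (hf : DifferentiableAt ℝ f q)
    (h : ℍ[ℝ]) :
    fderiv ℝ f q h = 4 * (ghrD (fun p => ((f p : ℝ) : ℍ[ℝ])) 1 q * h).re := by
  have expand : fderiv ℝ f q h = h.re * fderiv ℝ f q 1 + h.imI * fderiv ℝ f q qi
      + h.imJ * fderiv ℝ f q qj + h.imK * fderiv ℝ f q qk := by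
    conv_lhs => rw [Quaternion.eq_smul_one_add_smul_units h]
    simp only [map_add, map_smul, smul_eq_mul]
  rw [expand, ghrD]
  simp only [Quaternion.fderiv_coe_comp hf, one_mul, inv_one, mul_one]
  generalize fderiv ℝ f q 1 = a
  generalize fderiv ℝ f q qi = b
  generalize fderiv ℝ f q qj = c
  generalize fderiv ℝ f q qk = d
  simp [qi_components, qj_components, qk_components]
  ring
end

section
/- Stationary point characterization: let f : ℍ → ℝ be differentiable at q. Identifying f with the ℍ-valued function q ↦ ((f q : ℝ) : ℍ), the following are equivalent: (a) ∂f/∂q(q) = 0; (b) ∂f/∂q^*(q) = 0; (c) the real Fréchet derivative fderiv ℝ f q is the zero linear map. -/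
open Quaternion

/-- The directional derivative of a real-valued function, viewed as quaternion-valued. -/
theorem fderiv_quaternion_coe_apply {f : ℍ[ℝ] → ℝ} {q : ℍ[ℝ]} (hf : DifferentiableAt ℝ f q)
    (v : ℍ[ℝ]) :
    fderiv ℝ (fun p => ((f p : ℝ) : ℍ[ℝ])) q v = ((fderiv ℝ f q v : ℝ) : ℍ[ℝ]) := by
  have h : HasFDerivAt (fun p => ((f p : ℝ) : ℍ[ℝ]))
      ((algebraMapCLM ℝ ℍ[ℝ]).comp (fderiv ℝ f q)) q :=
    (algebraMapCLM ℝ ℍ[ℝ]).hasFDerivAt.comp q hf.hasFDerivAt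
  rw [h.fderiv]
  rfl

/-- A continuous real-linear functional on the quaternions vanishes iff it vanishes on the
basis `1, i, j, k`. -/
theorem quaternion_clm_eq_zero_iff (L : ℍ[ℝ] →L[ℝ] ℝ) :
    L = 0 ↔ L 1 = 0 ∧ L qi = 0 ∧ L qj = 0 ∧ L qk = 0 := by
  refine ⟨fun h => by simp [h], fun ⟨h1, hi, hj, hk⟩ => ?_⟩
  ext v
  have hv : v = v.re • (1 : ℍ[ℝ]) + v.imI • qi + v.imJ • qj + v.imK • qk := by
    ext <;> simp <;> simp [qi, qj, qk]
  rw [hv]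
  simp only [map_add, map_smul, h1, hi, hj, hk]
  simp

theorem ghrD_coe_eq_zero_iff {f : ℍ[ℝ] → ℝ} {q : ℍ[ℝ]} (hf : DifferentiableAt ℝ f q) :
    ghrD (fun p => ((f p : ℝ) : ℍ[ℝ])) 1 q = 0 ↔ fderiv ℝ f q = 0 := by
  simp [ghrD, fderiv_quaternion_coe_apply hf, quaternion_clm_eq_zero_iff, Quaternion.ext_iff]
  simp [qi, qj, qk]

theorem ghrDStar_coe_eq_zero_iff {f : ℍ[ℝ] → ℝ} {q : ℍ[ℝ]} (hf : DifferentiableAt ℝ f q) :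
    ghrDStar (fun p => ((f p : ℝ) : ℍ[ℝ])) 1 q = 0 ↔ fderiv ℝ f q = 0 := by
  simp [ghrDStar, fderiv_quaternion_coe_apply hf, quaternion_clm_eq_zero_iff, Quaternion.ext_iff]
  simp [qi, qj, qk]

/-- Stationary point characterization for a real-valued `f` differentiable at `q`:
`∂f/∂q(q) = 0 ↔ ∂f/∂q^*(q) = 0 ↔ fderiv ℝ f q = 0`. -/
theorem ghr_stationary_points (f : ℍ[ℝ] → ℝ) (q : ℍ[ℝ]) (hf : DifferentiableAt ℝ f q) :
    (ghrD (fun p => ((f p : ℝ) : ℍ[ℝ])) 1 q = 0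
        ↔ ghrDStar (fun p => ((f p : ℝ) : ℍ[ℝ])) 1 q = 0) ∧
    (ghrDStar (fun p => ((f p : ℝ) : ℍ[ℝ])) 1 q = 0 ↔ fderiv ℝ f q = 0) := by
  rw [ghrD_coe_eq_zero_iff hf, ghrDStar_coe_eq_zero_iff hf]
  exact ⟨Iff.rfl, Iff.rfl⟩
end

section
/- Second-order conjugate rule for real-valued functions: let f : ℍ → ℝ be twice continuously differentiable (ContDiff ℝ 2) and let μ, ν ∈ ℍ be nonzero. Identifying f with the ℍ-valued function q ↦ ((f q : ℝ) : ℍ), for every q ∈ ℍ the mixed second-order GHR derivatives satisfy star(∂(p ↦ ∂f/∂p^{ν*}(p))/∂q^μ(q)) = ∂(p ↦ ∂f/∂p^{μ*}(p))/∂q^ν(q). In particular, taking μ = ν = 1, the quaternion ∂(p ↦ ∂f/∂p^*(p))/∂q(q) is fixed by conjugation, i.e. it is real. -/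
open Quaternion

theorem fderiv_quaternion_coe {f : ℍ[ℝ] → ℝ} {q : ℍ[ℝ]} (hf : DifferentiableAt ℝ f q)
    (v : ℍ[ℝ]) :
    fderiv ℝ (fun r => ((f r : ℝ) : ℍ[ℝ])) q v = ((fderiv ℝ f q v : ℝ) : ℍ[ℝ]) := by
  have h := hf.hasFDerivAt.smul_const (1 : ℍ[ℝ])
  have e : (fun r => ((f r : ℝ) : ℍ[ℝ])) = fun r => f r • (1 : ℍ[ℝ]) := by
    ext1 r
    rw [← Quaternion.coe_mul_eq_smul, mul_one]
  rw [e, h.fderiv, ContinuousLinearMap.smulRight_apply, ← Quaternion.coe_mul_eq_smul, mul_one]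

theorem ghrDStar_coe {f : ℍ[ℝ] → ℝ} (hf : Differentiable ℝ f) (μ q : ℍ[ℝ]) :
    ghrDStar (fun r => ((f r : ℝ) : ℍ[ℝ])) μ q =
      (4 : ℝ)⁻¹ • (fderiv ℝ f q 1 • (1 : ℍ[ℝ]) + fderiv ℝ f q qi • (μ * qi * μ⁻¹)
        + fderiv ℝ f q qj • (μ * qj * μ⁻¹) + fderiv ℝ f q qk • (μ * qk * μ⁻¹)) := by
  simp only [ghrDStar, fderiv_quaternion_coe (hf q), ← Quaternion.coe_mul_eq_smul, mul_one]

theorem fderiv_ghrDStar_coe {f : ℍ[ℝ] → ℝ} (hf : ContDiff ℝ 2 f) (μ q v : ℍ[ℝ]) :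
    fderiv ℝ (fun p => ghrDStar (fun r => ((f r : ℝ) : ℍ[ℝ])) μ p) q v =
      (4 : ℝ)⁻¹ • (fderiv ℝ (fderiv ℝ f) q v 1 • (1 : ℍ[ℝ])
        + fderiv ℝ (fderiv ℝ f) q v qi • (μ * qi * μ⁻¹)
        + fderiv ℝ (fderiv ℝ f) q v qj • (μ * qj * μ⁻¹)
        + fderiv ℝ (fderiv ℝ f) q v qk • (μ * qk * μ⁻¹)) := by
  have hd : DifferentiableAt ℝ (fderiv ℝ f) q :=
    (hf.fderiv_right (m := 1) (by norm_num)).differentiable (by norm_num) q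
  have h (w c : ℍ[ℝ]) : HasFDerivAt (fun p => fderiv ℝ f p w • c)
      (((fderiv ℝ (fderiv ℝ f) q).flip w).smulRight c) q :=
    (((ContinuousLinearMap.apply ℝ ℝ w).hasFDerivAt).comp q hd.hasFDerivAt).smul_const c
  simp only [ghrDStar_coe (hf.differentiable (by norm_num))]
  have := ((((h 1 1).add (h qi (μ * qi * μ⁻¹))).add (h qj (μ * qj * μ⁻¹))).add
    (h qk (μ * qk * μ⁻¹))).const_smul (4 : ℝ)⁻¹
  erw [this.fderiv]
  rfl

theorem star_conj_of_star_eq_neg (μ : ℍ[ℝ]) {x : ℍ[ℝ]} (hx : star x = -x) :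
    star (μ * x * μ⁻¹) = -(μ * x * μ⁻¹) := by
  have hinv : μ⁻¹ = (normSq μ)⁻¹ • star μ := rfl
  rw [hinv]
  simp [hx, mul_assoc]

theorem star_ghrD_ghrDStar_coe {f : ℍ[ℝ] → ℝ} (hf : ContDiff ℝ 2 f) (μ ν q : ℍ[ℝ]) :
    star (ghrD (fun p => ghrDStar (fun r => ((f r : ℝ) : ℍ[ℝ])) ν p) μ q)
      = ghrD (fun p => ghrDStar (fun r => ((f r : ℝ) : ℍ[ℝ])) μ p) ν q := by
  have hs (v w : ℍ[ℝ]) :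
      fderiv ℝ (fderiv ℝ f) q v w = fderiv ℝ (fderiv ℝ f) q w v :=
    (hf.contDiffAt.isSymmSndFDerivAt (by simp)) v w
  have hi : star qi = -qi := Quaternion.star_eq_neg.mpr rfl
  have hj : star qj = -qj := Quaternion.star_eq_neg.mpr rfl
  have hk : star qk = -qk := Quaternion.star_eq_neg.mpr rfl
  have ha := star_conj_of_star_eq_neg μ hi
  have hb := star_conj_of_star_eq_neg μ hj
  have hc := star_conj_of_star_eq_neg μ hk
  have ha' := star_conj_of_star_eq_neg ν hi
  have hb' := star_conj_of_star_eq_neg ν hj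
  have hc' := star_conj_of_star_eq_neg ν hk
  simp only [ghrD, fderiv_ghrDStar_coe hf]
  rw [hs qi 1, hs qj 1, hs qk 1, hs qj qi, hs qk qi, hs qk qj]
  generalize μ * qi * μ⁻¹ = a, μ * qj * μ⁻¹ = b, μ * qk * μ⁻¹ = c,
    ν * qi * ν⁻¹ = a', ν * qj * ν⁻¹ = b', ν * qk * ν⁻¹ = c' at *
  simp only [Quaternion.star_smul, star_sub, star_add, star_mul, star_one, ha, hb, hc, ha', hb',
    hc']
  simp only [smul_mul_assoc, mul_smul_comm, add_mul, mul_add, neg_mul, mul_neg, one_mul, mul_one,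
    smul_neg]
  module

/-- Second-order conjugate rule for real-valued functions:
`star(∂²f/(∂q^μ ∂q^{ν*})(q)) = ∂²f/(∂q^ν ∂q^{μ*})(q)`; in particular
`∂²f/(∂q ∂q^*)(q)` is fixed by conjugation, i.e. real. -/
theorem ghr_second_order_conjugate_rule (f : ℍ[ℝ] → ℝ) (hf : ContDiff ℝ 2 f)
    (μ ν : ℍ[ℝ]) (hμ : μ ≠ 0) (hν : ν ≠ 0) (q : ℍ[ℝ]) :
    star (ghrD (fun p => ghrDStar (fun r => ((f r : ℝ) : ℍ[ℝ])) ν p) μ q)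
      = ghrD (fun p => ghrDStar (fun r => ((f r : ℝ) : ℍ[ℝ])) μ p) ν q ∧
    star (ghrD (fun p => ghrDStar (fun r => ((f r : ℝ) : ℍ[ℝ])) 1 p) 1 q)
      = ghrD (fun p => ghrDStar (fun r => ((f r : ℝ) : ℍ[ℝ])) 1 p) 1 q := by
  exact ⟨star_ghrD_ghrDStar_coe hf μ ν q, star_ghrD_ghrDStar_coe hf 1 1 q⟩
end
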